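/- arXiv:2305.11346 — 2 statements merged into one kernel-verified Lean document; each statement's English description precedes it below -/
import Mathlib

section
/- Let R be a multirelation from X to Y and S a multirelation from Y to Z. If R and S are both outer deterministic, or R and S are both inner deterministic, then α(R ∗ S) = α(R) ; α(S), i.e., for all a : X and c : Z, α(R ∗ S) a c holds if and only if there exists b : Y with α(R) a b and α(S) b c. -/
namespace MultiRel

variable {X Y Z : Type*}

/-- `α(R)` for a multirelation `R : X → Set Y → Prop`. -/
def alpha (R : X → Set Y → Prop) : X → Y → Prop := fun a b => ∃ B, R a B ∧ b ∈ B

/-- Peleg composition of multirelations. -/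
def peleg (R : X → Set Y → Prop) (S : Y → Set Z → Prop) : X → Set Z → Prop :=
  fun a C => ∃ B, R a B ∧ ∃ f : Y → Set Z, (∀ b ∈ B, S b (f b)) ∧ C = ⋃ b ∈ B, f b

/-- Relational composition. -/
def rcomp (T₁ : X → Y → Prop) (T₂ : Y → Z → Prop) : X → Z → Prop :=
  fun x z => ∃ y, T₁ x y ∧ T₂ y z

/-- Converse of a relation. -/
def conv (T : X → Y → Prop) : Y → X → Prop := fun b a => T a b

/-- Inner total part `ν(R)`. -/
def nu (R : X → Set Y → Prop) : X → Set Y → Prop := fun a B => R a B ∧ B.Nonempty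

/-- Down-closure `↓R`. -/
def down (R : X → Set Y → Prop) : X → Set Y → Prop := fun a A => ∃ B, R a B ∧ A ⊆ B

/-- Up-closure `↑R`. -/
def up (R : X → Set Y → Prop) : X → Set Y → Prop := fun a A => ∃ B, R a B ∧ B ⊆ A

/-- Outer determinisation `δo(R)`. -/
def deltao (R : X → Set Y → Prop) : X → Set Y → Prop :=
  fun a B => B = {b | ∃ C, R a C ∧ b ∈ C}

/-- Inner determinisation `δi(R)`. -/
def deltai (R : X → Set Y → Prop) : X → Set Y → Prop :=
  fun a B => ∃ b, (∃ C, R a C ∧ b ∈ C) ∧ B = {b}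

/-- Dual of a multirelation. -/
def mdual (S : X → Set Y → Prop) : X → Set Y → Prop := fun a B => ¬ S a Bᶜ

/-- Domain of a multirelation. -/
def domM (R : X → Set Y → Prop) : Set X := {a | ∃ B, R a B}

/-- Domain of a relation. -/
def domR (Q : X → Y → Prop) : Set X := {a | ∃ b, Q a b}

/-- Test restriction `R·P∗`. -/
def restr (R : X → Set Y → Prop) (P : Set Y) : X → Set Y → Prop := fun a B => R a B ∧ B ⊆ P

/-- Negated test restriction `R·¬P∗`. -/
def restrN (R : X → Set Y → Prop) (P : Set Y) : X → Set Y → Prop := fun a B => R a B ∧ ¬ B ⊆ P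

/-- `η(Q)` for a relation `Q`. -/
def eta (Q : X → Y → Prop) : X → Set Y → Prop := fun a B => ∃ b, Q a b ∧ B = {b}

/-- Power transpose `Λ(Q)` of a relation `Q`. -/
def Lam (Q : X → Y → Prop) : X → Set Y → Prop := fun a B => B = {b | Q a b}

/-- Peleg diamond `⟨R⟩∗ P`. -/
def diaP (R : X → Set Y → Prop) (P : Set Y) : Set X := {a | ∃ B, R a B ∧ B ⊆ P}

/-- Peleg box `[R]∗ P`. -/
def boxP (R : X → Set Y → Prop) (P : Set Y) : Set X := {a | ∀ B, R a B → (B ∩ P).Nonempty}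

/-- Nerode–Wijesekera diamond `⟨R⟩α P`. -/
def diaA (R : X → Set Y → Prop) (P : Set Y) : Set X := {a | ∃ B, R a B ∧ (B ∩ P).Nonempty}

/-- Nerode–Wijesekera box `[R]α P`. -/
def boxA (R : X → Set Y → Prop) (P : Set Y) : Set X := {a | ∀ B, R a B → B ⊆ P}

/-- Relational diamond `⟨Q⟩ᵣ P`. -/
def diaR (Q : X → Y → Prop) (P : Set Y) : Set X := {a | ∃ b, Q a b ∧ b ∈ P}

/-- Relational box `[Q]ᵣ P`. -/
def boxR (Q : X → Y → Prop) (P : Set Y) : Set X := {a | ∀ b, Q a b → b ∈ P}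

/-- Graph diamond `⟨Q⟩ᴳ`. -/
def diaG (Q : X → Y → Prop) : Set Y → Set X → Prop := fun A P => P = diaR Q A

/-- Graph box `[Q]ᴳ`. -/
def boxG (Q : X → Y → Prop) : Set Y → Set X → Prop := fun A P => P = boxR Q A

/-- Complementation relation `C` on `Set X`. -/
def Crel (X : Type*) : Set X → Set X → Prop := fun A B => B = Aᶜ

/-- Inclusion relation `Ω` on `Set X`. -/
def Omega (X : Type*) : Set X → Set X → Prop := fun A B => A ⊆ B

/-- Outer determinism: for every `a` there is exactly one `B` with `R a B`. -/
def outerDet (R : X → Set Y → Prop) : Prop := ∀ a, ∃! B, R a B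

/-- Inner determinism: every related set is a singleton. -/
def innerDet (R : X → Set Y → Prop) : Prop := ∀ a B, R a B → ∃ b, B = {b}

/-- Inner union `R ⋓ S`. -/
def iunion (R S : X → Set Y → Prop) : X → Set Y → Prop :=
  fun a D => ∃ B C, R a B ∧ S a C ∧ D = B ∪ C

/-- If every `R`-image that meets the domain of `S` is contained in the domain of `S`, then `α`
maps the Peleg composition of `R` and `S` to the relational composition. -/
theorem alpha_peleg_iff {X Y Z : Type*} {R : X → Set Y → Prop} {S : Y → Set Z → Prop}
    (hS : ∀ a B, R a B → ∀ b ∈ B, ∀ C, S b C → ∀ b' ∈ B, ∃ D, S b' D) (a : X) (c : Z) :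
    alpha (peleg R S) a c ↔ ∃ b : Y, alpha R a b ∧ alpha S b c := by
  classical
  constructor
  · rintro ⟨_, ⟨B, hR, f, hf, rfl⟩, hc⟩
    obtain ⟨b, hb, hc⟩ := Set.mem_iUnion₂.mp hc
    exact ⟨b, ⟨B, hR, hb⟩, f b, hf b hb, hc⟩
  · rintro ⟨b, ⟨B, hR, hb⟩, C, hC, hc⟩
    choose! g hg using hS a B hR b hb C hC
    refine ⟨_, ⟨B, hR, Function.update g b C, fun b' hb' => ?_, rfl⟩,
      Set.mem_iUnion₂.mpr ⟨b, hb, by simpa using hc⟩⟩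
    obtain rfl | hne := eq_or_ne b' b
    · simpa using hC
    · simpa [hne] using hg b' hb'

theorem alpha_peleg_eq_of_det {X Y Z : Type*} (R : X → Set Y → Prop) (S : Y → Set Z → Prop)
    (h : (outerDet R ∧ outerDet S) ∨ (innerDet R ∧ innerDet S)) :
    ∀ (a : X) (c : Z), alpha (peleg R S) a c ↔ ∃ b : Y, alpha R a b ∧ alpha S b c := by
  refine alpha_peleg_iff fun a B hR b hb C hC b' hb' => ?_
  obtain ⟨-, hS⟩ | ⟨hR', -⟩ := h
  · exact (hS b').exists
  · obtain ⟨d, rfl⟩ := hR' a B hR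
    obtain rfl : b = d := hb
    obtain rfl : b' = b := hb'
    exact ⟨C, hC⟩

end MultiRel
end

section
/- Goldblatt's axiom (G5) holds in the multirelational semantics: for multirelations R and S from X to Y and P : Set Y, [R ⋓ S]α P = ((⟨R⟩∗ Set.univ)ᶜ ∪ [S]α P) ∩ ((⟨S⟩∗ Set.univ)ᶜ ∪ [R]α P). -/
namespace MultiRel

variable {X Y Z : Type*}

theorem goldblatt_G5 {X Y : Type*} (R S : X → Set Y → Prop) (P : Set Y) :
    boxA (iunion R S) P =
      ((diaP R Set.univ)ᶜ ∪ boxA S P) ∩ ((diaP S Set.univ)ᶜ ∪ boxA R P) := by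
  ext a
  constructor
  · intro h
    constructor
    · by_cases hR : a ∈ diaP R Set.univ
      · obtain ⟨B, hB, -⟩ := hR
        exact Or.inr fun C hC => Set.subset_union_right.trans (h (B ∪ C) ⟨B, C, hB, hC, rfl⟩)
      · exact Or.inl hR
    · by_cases hS : a ∈ diaP S Set.univ
      · obtain ⟨C, hC, -⟩ := hS
        exact Or.inr fun B hB => Set.subset_union_left.trans (h (B ∪ C) ⟨B, C, hB, hC, rfl⟩)
      · exact Or.inl hS
  · rintro ⟨hS, hR⟩ D ⟨B, C, hB, hC, rfl⟩
    exact Set.union_subset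
      (hR.resolve_left (fun h => h ⟨C, hC, Set.subset_univ C⟩) B hB)
      (hS.resolve_left (fun h => h ⟨B, hB, Set.subset_univ B⟩) C hC)

end MultiRel
end
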